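/- Under the Setup, suppose additionally that whenever n−2 ∈ I_{n−2}^V we also have n−1 ∈ I_{n−2}^V. Then for each m with 1 < m < n−2, the necklace term I_m^W contributes the same plusses as I_m^V, except that if I_m^V contributed a plus in column n−3 of the Le diagram of V then that plus is shifted one square left (into column n−2) in the Le diagram of W. -/

import Mathlib

open scoped Classical

namespace WLD

/-- A propagator of a Wilson loop diagram on the cyclically ordered vertex set
`ZMod n` (vertex `n` is identified with `0`): an unordered pair of edges, the
edge joining vertex `i` to vertex `i+1` being labelled `i`. -/
abbrev Prp (n : ℕ) := Sym2 (ZMod n)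

variable (n : ℕ)

/-- The position of `x` in the linear order `i <_i i+1 <_i ⋯ <_i i-1`. -/
def ord (i x : ZMod n) : ℕ := (x - i).val

/-- The other end of a propagator `p` having an end on the edge `e`. -/
noncomputable def otherEnd (p : Prp n) (e : ZMod n) : ZMod n :=
  if h : e ∈ p then Sym2.Mem.other h else e

/-- The vertex support `V(p) = {i, i+1, j, j+1}` of the propagator `p = (i,j)`. -/
def supp (p : Prp n) : Finset (ZMod n) :=
  Sym2.lift ⟨fun i j => {i, i + 1, j, j + 1}, fun i j => by
    ext x
    simp only [Finset.mem_insert, Finset.mem_singleton]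
    tauto⟩ p

/-- The vertex support `V(Q)` of a set of propagators. -/
def suppSet (Q : Finset (Prp n)) : Finset (ZMod n) := Q.biUnion (supp n)

/-- `Prop(U)`: the propagators of `P` supported on (a vertex of) `U`. -/
noncomputable def propsOn (P : Finset (Prp n)) (U : Finset (ZMod n)) : Finset (Prp n) :=
  P.filter fun p => (supp n p ∩ U).Nonempty

/-- Two propagators `p = (i,j)` and `q = (k,l)` cross if `i < k < j < l` cyclically. -/
def Crossing (p q : Prp n) : Prop :=
  ∃ i j k l : ZMod n, p = s(i, j) ∧ q = s(k, l) ∧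
    0 < ord n i k ∧ ord n i k < ord n i j ∧ ord n i j < ord n i l

/-- Weak admissibility of a Wilson loop diagram. -/
structure IsWeaklyAdmissible (P : Finset (Prp n)) : Prop where
  dense : ∀ Q ⊆ P, Q.Nonempty → Q.card + 3 ≤ (suppSet n Q).card
  noncross : ∀ p ∈ P, ∀ q ∈ P, ¬ Crossing n p q

/-- Admissibility of a Wilson loop diagram. -/
structure IsAdmissible (P : Finset (Prp n)) : Prop where
  card_add_four_le : P.card + 4 ≤ n
  dense : ∀ Q ⊆ P, Q.Nonempty → Q.card + 3 ≤ (suppSet n Q).card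
  noncross : ∀ p ∈ P, ∀ q ∈ P, ¬ Crossing n p q

/-- The length of a propagator `p = (i,j)`:
`min(|[i+1, j]|, |[j+1, i]|)`, the number of vertices on its smaller side. -/
def plength (p : Prp n) : ℕ :=
  Sym2.lift ⟨fun i j => min ((j - i - 1).val + 1) ((i - j - 1).val + 1),
    fun _ _ => min_comm _ _⟩ p

/-- `InsideDir n i p q` : the propagator `q = (k,l)` lies (weakly) inside the
propagator `p = (i,j)` directed from its end `i`, i.e. `i ≤_i k <_i l ≤_i j`. -/
def InsideDir (i : ZMod n) (p q : Prp n) : Prop :=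
  ∃ j k l : ZMod n, p = s(i, j) ∧ q = s(k, l) ∧
    ord n i k < ord n i l ∧ ord n i l ≤ ord n i j

/-- Sorting key measuring how far clockwise of the vertex `a` the relevant end of
a propagator supported on `a` is attached: ends on the edge `a-1` are clockwise of
ends on the edge `a`, and on a fixed edge an end is the more clockwise the larger
the propagator is (nestedness of noncrossing propagators sharing an edge). -/
noncomputable def cwKey (a : ZMod n) (p : Prp n) : ℕ :=
  if a - 1 ∈ p then n + ord n (a - 1) (otherEnd n p (a - 1))
  else ord n a (otherEnd n p a)

/-- The clockwise-most propagator of `S` supported on the vertex `a`, if any. -/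
noncomputable def pickCW (S : Finset (Prp n)) (a : ZMod n) : Option (Prp n) :=
  if h : (S.filter fun p => a ∈ supp n p).Nonempty then
    some (Classical.choose
      ((S.filter fun p => a ∈ supp n p).exists_max_image (cwKey n a) h))
  else none

/-- The Grassmann necklace algorithm started at the vertex `i`: after `t` steps,
`(gnRun n P i t).1` is the set of propagators not yet deleted, and
`(gnRun n P i t).2` records the vertex assigned to each deleted propagator.
Step `t+1` processes the vertex `i + t`: if some not-yet-deleted propagator is
supported on it, the clockwise-most such propagator is deleted and assigned
that vertex. -/
noncomputable def gnRun (P : Finset (Prp n)) (i : ZMod n) :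
    ℕ → Finset (Prp n) × (Prp n → Option (ZMod n))
  | 0 => (P, fun _ => none)
  | t + 1 =>
    match pickCW n (gnRun P i t).1 (i + (t : ZMod n)) with
    | none => gnRun P i t
    | some p => ((gnRun P i t).1.erase p,
        Function.update (gnRun P i t).2 p (some (i + (t : ZMod n))))

/-- `I_i^W(p)`: the vertex contributed by the propagator `p` to the Grassmann
necklace term `I_i^W` (as an `Option`; the algorithm makes one full circuit of
the vertex set, i.e. runs for `n` steps). -/
noncomputable def gnAssign (P : Finset (Prp n)) (i : ZMod n) (p : Prp n) :
    Option (ZMod n) :=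
  (gnRun n P i n).2 p

/-- The Grassmann necklace term `I_i^W` produced by the algorithm. -/
noncomputable def gnSet [NeZero n] (P : Finset (Prp n)) (i : ZMod n) :
    Finset (ZMod n) :=
  Finset.univ.filter fun v => ∃ p, gnAssign n P i p = some v

/-- The cyclic interval `{a, a+1, …, a + (len-1)}` in `ZMod n`. -/
def cInterval [NeZero n] (a : ZMod n) (len : ℕ) : Finset (ZMod n) :=
  Finset.univ.filter fun x => ord n a x < len

/-- A Grassmann necklace of type `(k, n)`: a cyclic sequence of `k`-element
subsets of the vertex set such that `I_{i+1} = (I_i \ {i}) ∪ {j}` for some `j`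
whenever `i ∈ I_i`, and `I_{i+1} = I_i` otherwise. -/
def IsGrassmannNecklace [NeZero n] (k : ℕ) (I : ZMod n → Finset (ZMod n)) : Prop :=
  (∀ i, (I i).card = k) ∧
  ∀ i : ZMod n,
    (i ∈ I i → ∃ j : ZMod n, I (i + 1) = insert j ((I i).erase i)) ∧
    (i ∉ I i → I (i + 1) = I i)

/-- Independence in the matroid `M(W)`: no subset `U` of `J` supports fewer
propagators than the vertices it contains. -/
def Indep (P : Finset (Prp n)) (J : Finset (ZMod n)) : Prop :=
  ∀ U ⊆ J, U.card ≤ (propsOn n P U).card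

/-- `A` is lexicographically smaller than `B` with respect to the order `<_i`:
the `<_i`-least element of the symmetric difference lies in `A`. -/
def LexLt (i : ZMod n) (A B : Finset (ZMod n)) : Prop :=
  ∃ v, v ∈ A ∧ v ∉ B ∧ ∀ w, ord n i w < ord n i v → (w ∈ A ↔ w ∈ B)

/-- A `+` is placed in the box `(a, b)` of the Le diagram with row labels `I₁`
by the necklace term `Ii`: writing `I₁ \ Ii = {a₁ > ⋯ > a_r}` and
`Ii \ I₁ = {b₁ < ⋯ < b_r}` in the `<₁` order, the plusses are in the boxes
`(a_t, b_t)`. -/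
def LePlusAt (I₁ Ii : Finset (ZMod n)) (a b : ZMod n) : Prop :=
  a ∈ I₁ \ Ii ∧ b ∈ Ii \ I₁ ∧
    ((I₁ \ Ii).filter fun x => ord n 1 a < ord n 1 x).card =
      ((Ii \ I₁).filter fun y => ord n 1 y < ord n 1 b).card

/-- The box `(a, b)` of the Le diagram of the diagram `P` contains a `+`. -/
def LePlus [NeZero n] (P : Finset (Prp n)) (a b : ZMod n) : Prop :=
  ∃ i : ZMod n, LePlusAt n (gnSet n P 1) (gnSet n P i) a b

/-- The number of `+` entries in the Le diagram of the diagram `P`. -/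
noncomputable def plusCount [NeZero n] (P : Finset (Prp n)) : ℕ :=
  (Finset.univ.filter fun ab : ZMod n × ZMod n => LePlus n P ab.1 ab.2).card

/-- The length of the row labelled `a` of the Young diagram with row labels `I₁`
(the boxes of row `a` are indexed by the column labels `b ∉ I₁` with `a <₁ b`). -/
noncomputable def rowLen [NeZero n] (I₁ : Finset (ZMod n)) (a : ZMod n) : ℕ :=
  (Finset.univ.filter fun b => b ∉ I₁ ∧ ord n 1 a < ord n 1 b).card

/-- The entry of the matrix `C(W)` in row `p` and column `q`: the indeterminate
`x_{p,q}` if `q ∈ V(p)`, and `0` otherwise. -/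
noncomputable def CW (p : Prp n) (q : ZMod n) : MvPolynomial (Prp n × ZMod n) ℝ :=
  if q ∈ supp n p then MvPolynomial.X (p, q) else 0

/-- The column paired with the row `p` in the minors determined by `I_i^W`. -/
noncomputable def colOf (P : Finset (Prp n)) (i : ZMod n) (p : Prp n) : ZMod n :=
  (gnAssign n P i p).getD i

/-- `Δ_{I_i}`: the determinant of the `k × k` minor of `C(W)` on the columns
indexed by `I_i^W`, rows and columns paired via the necklace assignment. -/
noncomputable def Delta (P : Finset (Prp n)) (i : ZMod n) :
    MvPolynomial (Prp n × ZMod n) ℝ :=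
  Matrix.det (Matrix.of fun p q : ↥P => CW n (p : Prp n) (colOf n P i (q : Prp n)))

/-- `S_i`: the propagators whose contribution changes from `I_{i-1}` to `I_i`. -/
noncomputable def Schanged (P : Finset (Prp n)) (i : ZMod n) : Finset (Prp n) :=
  P.filter fun p => gnAssign n P (i - 1) p ≠ gnAssign n P i p

/-- `r_i`: the determinant of the minor of `C(W)` with rows indexed by `S_i` and
columns indexed by `I_i(S_i)` (equal to `1` when `S_i = ∅`). -/
noncomputable def rfac (P : Finset (Prp n)) (i : ZMod n) :
    MvPolynomial (Prp n × ZMod n) ℝ :=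
  Matrix.det
    (Matrix.of fun p q : ↥(Schanged n P i) => CW n (p : Prp n) (colOf n P i (q : Prp n)))

/-- `R = ∏ᵢ rᵢ`, the polynomial produced by the algorithm. -/
noncomputable def Rpoly [NeZero n] (P : Finset (Prp n)) :
    MvPolynomial (Prp n × ZMod n) ℝ :=
  ∏ i : ZMod n, rfac n P i

/-- Position of the end of the propagator `p` along the edge `e`: larger values
attach closer to the vertex `e`, i.e. earlier in the counterclockwise ordering
of the ends of propagators along the edge `e`. -/
noncomputable def edgeKey (e : ZMod n) (p : Prp n) : ℕ := ord n e (otherEnd n p e)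

/-- The propagators of `P` with an end on the edge `e`. -/
noncomputable def onEdge (P : Finset (Prp n)) (e : ZMod n) : Finset (Prp n) :=
  P.filter fun p => e ∈ p

/-- `p` is the first propagator (`p₁`) on the edge `e` in the counterclockwise
ordering of the propagators with an end on the edge `e`. -/
def IsCcwFirst (P : Finset (Prp n)) (e : ZMod n) (p : Prp n) : Prop :=
  p ∈ onEdge n P e ∧ ∀ q ∈ onEdge n P e, edgeKey n e q ≤ edgeKey n e p

/-- `p` is the last propagator (`p_r`) on the edge `e` in the counterclockwise
ordering of the propagators with an end on the edge `e`. -/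
def IsCcwLast (P : Finset (Prp n)) (e : ZMod n) (p : Prp n) : Prop :=
  p ∈ onEdge n P e ∧ ∀ q ∈ onEdge n P e, edgeKey n e p ≤ edgeKey n e q

/-- `p` and `q` are consecutive, in this order (`p = p_j`, `q = p_{j+1}`), in the
counterclockwise ordering of the propagators with an end on the edge `e`. -/
def ConsecOnEdge (P : Finset (Prp n)) (e : ZMod n) (p q : Prp n) : Prop :=
  p ∈ onEdge n P e ∧ q ∈ onEdge n P e ∧ edgeKey n e q < edgeKey n e p ∧
    ∀ r ∈ onEdge n P e, ¬ (edgeKey n e q < edgeKey n e r ∧ edgeKey n e r < edgeKey n e p)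

/-- The factor `R_e` of the denominator `R(W)` associated to the edge `e`:
`R_e = x_{p₁,e+1} • ∏_{j=1}^{r-1} (x_{p_j,e} x_{p_{j+1},e+1} - x_{p_{j+1},e} x_{p_j,e+1}) • x_{p_r,e}`
for the counterclockwise ordering `p₁, …, p_r` of the propagators on the edge `e`
(`R_e = 1` if there are none). -/
noncomputable def Redge (P : Finset (Prp n)) (e : ZMod n) :
    MvPolynomial (Prp n × ZMod n) ℝ :=
  (∏ p ∈ (onEdge n P e).filter (IsCcwFirst n P e), MvPolynomial.X (p, e + 1)) *
    (∏ pq ∈ (P ×ˢ P).filter (fun pq => ConsecOnEdge n P e pq.1 pq.2),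
      (MvPolynomial.X (pq.1, e) * MvPolynomial.X (pq.2, e + 1) -
        MvPolynomial.X (pq.2, e) * MvPolynomial.X (pq.1, e + 1))) *
    (∏ p ∈ (onEdge n P e).filter (IsCcwLast n P e), MvPolynomial.X (p, e))

/-- The denominator `R(W) = ∏ₑ R_e` of the integrand `Ω(W)`. -/
noncomputable def RW [NeZero n] (P : Finset (Prp n)) :
    MvPolynomial (Prp n × ZMod n) ℝ :=
  ∏ e : ZMod n, Redge n P e

/-- The relabelling map associated to the removal of the vertex `i` from the
vertex set `ZMod n`: the vertex of `ZMod (n-1)` in position `t` (in the `<₁`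
order) is sent to the vertex of `ZMod n` in position `t` if `t` precedes the
position of `i`, and to the vertex in position `t+1` otherwise. -/
noncomputable def liftVert (i : ZMod n) (x : ZMod (n - 1)) : ZMod n :=
  1 + ((if ord (n - 1) 1 x < ord n 1 i then ord (n - 1) 1 x
        else ord (n - 1) 1 x + 1 : ℕ) : ZMod n)

end WLD
namespace WLD

/-- The diagram `V` of the Setup: the diagram `W` with the length-2 propagator
`p = (n-3, n-1)` removed. -/
noncomputable def eraseP (n : ℕ) (P : Finset (Prp n)) : Finset (Prp n) :=
  P.erase (s(-3, -1) : Prp n)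

section RunLemmas

variable {n : ℕ}

lemma ord_add_natCast (c : ZMod n) {k : ℕ} (hk : k < n) : ord n c (c + k) = k := by
  simp [ord, ZMod.val_natCast_of_lt hk]

lemma ord_eq_of_eq {c x : ZMod n} {k : ℕ} (hk : k < n) (h : x = c + k) : ord n c x = k := by
  rw [h, ord_add_natCast c hk]

lemma add_ord [NeZero n] (c x : ZMod n) : c + (ord n c x : ZMod n) = x := by
  simp [ord]

lemma ord_lt [NeZero n] (c x : ZMod n) : ord n c x < n := ZMod.val_lt _

lemma ord_inj [NeZero n] {c x y : ZMod n} : ord n c x = ord n c y ↔ x = y :=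
  ⟨fun h => by rw [← add_ord c x, h, add_ord], fun h => by rw [h]⟩

lemma mem_supp {p : Prp n} {a : ZMod n} : a ∈ supp n p ↔ a ∈ p ∨ a - 1 ∈ p := by
  induction p using Sym2.ind with
  | _ i j =>
    simp only [supp, Sym2.lift_mk, Finset.mem_insert, Finset.mem_singleton, Sym2.mem_iff,
      sub_eq_iff_eq_add]
    tauto

lemma mk_otherEnd {p : Prp n} {e : ZMod n} (h : e ∈ p) : s(e, otherEnd n p e) = p := by
  rw [otherEnd, dif_pos h]
  exact Sym2.other_spec h

lemma otherEnd_mk (e f : ZMod n) : otherEnd n s(e, f) e = f :=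
  Sym2.congr_right.1 (mk_otherEnd (Sym2.mem_mk_left e f))

lemma cwKey_inj [NeZero n] {a : ZMod n} {p q : Prp n} (hp : a ∈ supp n p) (hq : a ∈ supp n q)
    (h : cwKey n a p = cwKey n a q) : p = q := by
  rw [mem_supp] at hp hq
  unfold cwKey at h
  split_ifs at h with h1 h2 h2
  · rw [← mk_otherEnd h1, ← mk_otherEnd h2, ord_inj.1 (Nat.add_left_cancel h)]
  · have := ord_lt a (otherEnd n q a); omega
  · have := ord_lt a (otherEnd n p a); omega
  · rw [← mk_otherEnd (hp.resolve_right h1), ← mk_otherEnd (hq.resolve_right h2), ord_inj.1 h]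

lemma pickCW_eq_none {S : Finset (Prp n)} {a : ZMod n} :
    pickCW n S a = none ↔ ∀ p ∈ S, a ∉ supp n p := by
  unfold pickCW
  split_ifs with h
  · simp only [false_iff]
    obtain ⟨p, hp⟩ := h
    rw [Finset.mem_filter] at hp
    exact fun H => H p hp.1 hp.2
  · simpa [Finset.not_nonempty_iff_eq_empty, Finset.filter_eq_empty_iff] using h

lemma pickCW_spec {S : Finset (Prp n)} {a : ZMod n} {p : Prp n} (h : pickCW n S a = some p) :
    p ∈ S ∧ a ∈ supp n p ∧ ∀ q ∈ S, a ∈ supp n q → cwKey n a q ≤ cwKey n a p := by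
  unfold pickCW at h
  split_ifs at h with hne
  have hs := Classical.choose_spec
    ((S.filter fun p => a ∈ supp n p).exists_max_image (cwKey n a) hne)
  rw [Option.some.inj h] at hs
  simp only [Finset.mem_filter] at hs
  exact ⟨hs.1.1, hs.1.2, fun q hq hqa => hs.2 q ⟨hq, hqa⟩⟩

lemma pickCW_eq_some [NeZero n] {S : Finset (Prp n)} {a : ZMod n} {p : Prp n} (hp : p ∈ S)
    (ha : a ∈ supp n p) (hmax : ∀ q ∈ S, a ∈ supp n q → cwKey n a q ≤ cwKey n a p) :
    pickCW n S a = some p := by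
  cases h : pickCW n S a with
  | none => exact absurd ha (pickCW_eq_none.1 h p hp)
  | some q =>
    obtain ⟨hq, hqa, hqmax⟩ := pickCW_spec h
    rw [cwKey_inj hqa ha (le_antisymm (hmax q hq hqa) (hqmax p hp ha))]

lemma pickCW_insert [NeZero n] {S : Finset (Prp n)} {a : ZMod n} {p : Prp n}
    (ha : a ∉ supp n p) : pickCW n (insert p S) a = pickCW n S a := by
  cases h : pickCW n S a with
  | none =>
    rw [pickCW_eq_none] at h ⊢
    exact fun q hq => (Finset.mem_insert.1 hq).elim (fun e => e ▸ ha) (h q)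
  | some q =>
    obtain ⟨hq, hqa, hqmax⟩ := pickCW_spec h
    refine pickCW_eq_some (Finset.mem_insert_of_mem hq) hqa fun r hr hra => ?_
    rcases Finset.mem_insert.1 hr with rfl | hr
    · exact absurd hra ha
    · exact hqmax r hr hra

/-- The propagator deleted at the vertex `i + t` by the algorithm started at `i`. -/
noncomputable def gnPick (P : Finset (Prp n)) (i : ZMod n) (t : ℕ) : Option (Prp n) :=
  pickCW n (gnRun n P i t).1 (i + (t : ZMod n))

lemma gnRun_succ_of_none {P : Finset (Prp n)} {i : ZMod n} {t : ℕ} (h : gnPick P i t = none) :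
    gnRun n P i (t + 1) = gnRun n P i t := by
  rw [gnPick] at h
  rw [gnRun, h]

lemma gnRun_succ_of_some {P : Finset (Prp n)} {i : ZMod n} {t : ℕ} {p : Prp n}
    (h : gnPick P i t = some p) :
    gnRun n P i (t + 1) = ((gnRun n P i t).1.erase p,
      Function.update (gnRun n P i t).2 p (some (i + (t : ZMod n)))) := by
  rw [gnPick] at h
  rw [gnRun, h]

lemma gnRun_fst_subset (P : Finset (Prp n)) (i : ZMod n) (t : ℕ) : (gnRun n P i t).1 ⊆ P := by
  induction t with
  | zero => exact subset_rfl
  | succ t ih =>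
    cases h : gnPick P i t with
    | none => rwa [gnRun_succ_of_none h]
    | some p =>
      rw [gnRun_succ_of_some h]
      exact (Finset.erase_subset _ _).trans ih

lemma gnRun_snd_eq_none {P : Finset (Prp n)} {i : ZMod n} {t : ℕ} {p : Prp n}
    (hp : p ∈ (gnRun n P i t).1) : (gnRun n P i t).2 p = none := by
  induction t with
  | zero => rfl
  | succ t ih =>
    cases h : gnPick P i t with
    | none =>
      rw [gnRun_succ_of_none h] at hp ⊢
      exact ih hp
    | some q =>
      rw [gnRun_succ_of_some h] at hp ⊢
      obtain ⟨h1, h2⟩ := Finset.mem_erase.1 hp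
      simpa [Function.update_of_ne h1] using ih h2

lemma exists_gnRun_snd_eq_some {P : Finset (Prp n)} {i v : ZMod n} {T : ℕ} :
    (∃ p, (gnRun n P i T).2 p = some v) ↔
      ∃ t < T, v = i + (t : ZMod n) ∧ gnPick P i t ≠ none := by
  induction T with
  | zero => simp [gnRun]
  | succ T ih =>
    have hsplit : (∃ t < T + 1, v = i + (t : ZMod n) ∧ gnPick P i t ≠ none) ↔
        (∃ t < T, v = i + (t : ZMod n) ∧ gnPick P i t ≠ none) ∨
          (v = i + (T : ZMod n) ∧ gnPick P i T ≠ none) := by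
      constructor
      · rintro ⟨t, ht, h⟩
        rcases Nat.lt_succ_iff_lt_or_eq.1 ht with ht | rfl
        · exact .inl ⟨t, ht, h⟩
        · exact .inr h
      · rintro (⟨t, ht, h⟩ | h)
        · exact ⟨t, by omega, h⟩
        · exact ⟨T, by omega, h⟩
    rw [hsplit, ← ih]
    cases h : gnPick P i T with
    | none => simp [gnRun_succ_of_none h]
    | some q =>
      have hq : (gnRun n P i T).2 q = none := gnRun_snd_eq_none (pickCW_spec h).1
      rw [gnRun_succ_of_some h]
      constructor
      · rintro ⟨p, hp⟩
        by_cases hpq : p = q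
        · subst hpq
          exact .inr ⟨by simpa using hp.symm, by simp⟩
        · exact .inl ⟨p, by simpa [Function.update_of_ne hpq] using hp⟩
      · rintro (⟨p, hp⟩ | ⟨rfl, -⟩)
        · have hpq : p ≠ q := by rintro rfl; simp [hq] at hp
          exact ⟨p, by simpa [Function.update_of_ne hpq] using hp⟩
        · exact ⟨q, by simp⟩

lemma mem_gnSet [NeZero n] {P : Finset (Prp n)} {i v : ZMod n} :
    v ∈ gnSet n P i ↔ gnPick P i (ord n i v) ≠ none := by
  rw [gnSet, Finset.mem_filter]
  simp only [Finset.mem_univ, true_and, gnAssign]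
  rw [exists_gnRun_snd_eq_some]
  constructor
  · rintro ⟨t, ht, hv, h⟩
    rwa [ord_eq_of_eq ht hv]
  · exact fun h => ⟨_, ord_lt _ _, (add_ord _ _).symm, h⟩

lemma gnRun_fst_subset_of_later_start [NeZero n] (P : Finset (Prp n)) (i : ZMod n) (d t : ℕ) :
    (gnRun n P i (d + t)).1 ⊆ (gnRun n P (i + (d : ZMod n)) t).1 := by
  induction t with
  | zero => exact gnRun_fst_subset P i d
  | succ t ih =>
    have hv : i + ((d + t : ℕ) : ZMod n) = i + (d : ZMod n) + (t : ZMod n) := by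
      push_cast; ring
    have hstep : (gnRun n P i (d + t + 1)).1 ⊆ (gnRun n P i (d + t)).1 := by
      cases h : gnPick P i (d + t) with
      | none => rw [gnRun_succ_of_none h]
      | some p => rw [gnRun_succ_of_some h]; exact Finset.erase_subset _ _
    rw [← add_assoc]
    cases h : gnPick P (i + (d : ZMod n)) t with
    | none => rw [gnRun_succ_of_none h]; exact hstep.trans ih
    | some p =>
      rw [gnRun_succ_of_some h]
      refine Finset.subset_erase.2 ⟨hstep.trans ih, fun hp => ?_⟩
      obtain ⟨-, hpa, hmax⟩ := pickCW_spec h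
      have hpick : gnPick P i (d + t) = some p := by
        unfold gnPick
        rw [hv]
        exact pickCW_eq_some (hstep hp) hpa fun q hq => hmax q (ih hq)
      rw [gnRun_succ_of_some hpick] at hp
      simp at hp

lemma mem_gnSet_of_mem_gnSet [NeZero n] {P : Finset (Prp n)} {i m v : ZMod n}
    (hmv : ord n i m ≤ ord n i v) (h : v ∈ gnSet n P i) : v ∈ gnSet n P m := by
  obtain ⟨t, ht⟩ := Nat.exists_eq_add_of_le hmv
  have hv : v = m + (t : ZMod n) := by
    rw [← add_ord i v, ht, Nat.cast_add, ← add_assoc, add_ord]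
  have htn : ord n m v = t := ord_eq_of_eq (by have := ord_lt i v; omega) hv
  rw [mem_gnSet, ht] at h
  rw [mem_gnSet, htn]
  contrapose! h
  unfold gnPick at h ⊢
  rw [pickCW_eq_none] at h ⊢
  have hsub := gnRun_fst_subset_of_later_start P i (ord n i m) t
  rw [add_ord] at hsub
  rw [Nat.cast_add, ← add_assoc, add_ord]
  exact fun p hp => h p (hsub hp)

/-- No propagator ends on the middle edge spanned by a length-2 propagator with nothing inside. -/
lemma middle_edge_notMem [NeZero n] {P : Finset (Prp n)} (hadm : IsAdmissible n P) {c : ZMod n}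
    (hp : (s(c, c + 2) : Prp n) ∈ P)
    (hin : ∀ r ∈ P, InsideDir n c s(c, c + 2) r → r = s(c, c + 2)) {r : Prp n} (hr : r ∈ P) :
    c + 1 ∉ r := by
  intro hmem
  have hn : 4 ≤ n := le_trans (by omega) hadm.card_add_four_le
  have h0 : ord n c c = 0 := by simp [ord]
  have h1 : ord n c (c + 1) = 1 := ord_eq_of_eq (by omega) (by simp)
  have h2 : ord n c (c + 2) = 2 := ord_eq_of_eq (by omega) (by simp)
  have hpr : c + 1 ∉ (s(c, c + 2) : Prp n) := by
    rw [Sym2.mem_iff]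
    rintro (h | h)
    · rw [h, h0] at h1; omega
    · rw [h, h2] at h1; omega
  have hout : ¬ InsideDir n c s(c, c + 2) r := fun h => hpr (hin r hr h ▸ hmem)
  obtain ⟨l, rfl⟩ := Sym2.mem_iff_exists.1 hmem
  have hcard := hadm.dense {s(c + 1, l)} (by simpa using hr) (by simp)
  have hl1 : l ≠ c + 1 := by
    rintro rfl
    have : suppSet n {s(c + 1, c + 1)} ⊆ {c + 1, c + 1 + 1} := by
      intro x; simp [suppSet, supp]
    have := (Finset.card_le_card this).trans Finset.card_le_two
    simp at hcard
    omega
  have hne : ord n c l ≠ 0 := fun h => hout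
    ⟨c + 2, l, c + 1, rfl, Sym2.eq_swap, by omega, by omega⟩
  have hne1 : ord n c l ≠ 1 := fun h => hl1 (ord_inj.1 (h.trans h1.symm))
  have hgt : 2 < ord n c l := by
    by_contra h
    exact hout ⟨c + 2, c + 1, l, rfl, rfl, by omega, by omega⟩
  exact hadm.noncross _ hp _ hr ⟨c, c + 2, c + 1, l, rfl, rfl, by omega, by omega, by omega⟩

lemma lePlusAt_swap_iff [NeZero n] {A B A' B' : Finset (ZMod n)} {u w a b : ZMod n}
    (huw : ord n 1 w = ord n 1 u + 1)
    (hA : ∀ v, v ≠ u → v ≠ w → (v ∈ A' ↔ v ∈ A)) (hB : ∀ v, v ≠ u → v ≠ w → (v ∈ B' ↔ v ∈ B))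
    (huA : u ∈ A') (huB : u ∈ B') (hwA : w ∈ A' ↔ u ∈ A) (hwB : w ∈ B' ↔ u ∈ B)
    (hwA' : w ∉ A) (hwB' : w ∉ B) (hAB : u ∈ A → u ∈ B) :
    LePlusAt n A' B' a b ↔ (b ≠ u ∧ LePlusAt n A B a b) ∨ (b = w ∧ LePlusAt n A B a u) := by
  have hne : w ≠ u := by rintro rfl; omega
  have hrow : A' \ B' = A \ B := by
    ext v
    simp only [Finset.mem_sdiff]
    by_cases h1 : v = u
    · subst h1; tauto
    by_cases h2 : v = w
    · subst h2; tauto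
    rw [hA v h1 h2, hB v h1 h2]
  have hcol (v) : v ∈ B' \ A' ↔ Equiv.swap u w v ∈ B \ A := by
    simp only [Finset.mem_sdiff]
    by_cases h1 : v = u
    · subst h1; rw [Equiv.swap_apply_left]; tauto
    by_cases h2 : v = w
    · subst h2; rw [Equiv.swap_apply_right]; tauto
    rw [Equiv.swap_apply_of_ne_of_ne h1 h2, hA v h1 h2, hB v h1 h2]
  have hwBA : w ∉ B \ A := fun h => hwB' (Finset.mem_sdiff.1 h).1
  have hcard (hb : b ≠ u) :
      ((B' \ A').filter fun y => ord n 1 y < ord n 1 b).card =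
        ((B \ A).filter fun y => ord n 1 y < ord n 1 (Equiv.swap u w b)).card := by
    refine Finset.card_equiv (Equiv.swap u w) fun v => ?_
    rw [Finset.mem_filter, Finset.mem_filter, hcol]
    refine and_congr_right fun hv => ?_
    have hvu : v ≠ u := by rintro rfl; rw [Equiv.swap_apply_left] at hv; exact hwBA hv
    have hvu' : ord n 1 v ≠ ord n 1 u := fun h => hvu (ord_inj.1 h)
    have hbu' : ord n 1 b ≠ ord n 1 u := fun h => hb (ord_inj.1 h)
    by_cases h1 : v = w <;> by_cases h2 : b = w
    · subst h1; subst h2; simp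
    · have hbw' : ord n 1 b ≠ ord n 1 w := fun h => h2 (ord_inj.1 h)
      rw [h1, Equiv.swap_apply_right, Equiv.swap_apply_of_ne_of_ne hb h2]
      omega
    · have hvw' : ord n 1 v ≠ ord n 1 w := fun h => h1 (ord_inj.1 h)
      rw [h2, Equiv.swap_apply_right, Equiv.swap_apply_of_ne_of_ne hvu h1]
      omega
    · rw [Equiv.swap_apply_of_ne_of_ne hb h2, Equiv.swap_apply_of_ne_of_ne hvu h1]
  have hkey (hb : b ≠ u) : LePlusAt n A' B' a b ↔ LePlusAt n A B a (Equiv.swap u w b) := by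
    unfold LePlusAt
    rw [hrow, hcol, hcard hb]
  by_cases hb : b = u
  · subst hb
    have : ¬ LePlusAt n A' B' a b := fun h => (Finset.mem_sdiff.1 h.2.1).2 huA
    simp [this, hne.symm]
  · rw [hkey hb]
    by_cases h2 : b = w
    · subst h2
      have : ¬ LePlusAt n A B a b := fun h => hwBA h.2.1
      simp [this]
    · simp [hb, h2, Equiv.swap_apply_of_ne_of_ne hb h2]

lemma gnRun_fst_step {P Q : Finset (Prp n)} {i : ZMod n} {t : ℕ}
    (h : (gnRun n P i t).1 = (gnRun n Q i t).1) :
    gnPick P i t = gnPick Q i t ∧ (gnRun n P i (t + 1)).1 = (gnRun n Q i (t + 1)).1 := by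
  have hpick : gnPick P i t = gnPick Q i t := by rw [gnPick, gnPick, h]
  refine ⟨hpick, ?_⟩
  cases hQ : gnPick Q i t with
  | none => rw [gnRun_succ_of_none hQ, gnRun_succ_of_none (hpick.trans hQ), h]
  | some x => rw [gnRun_succ_of_some hQ, gnRun_succ_of_some (hpick.trans hQ), h]

/-- Effect on the algorithm of removing a propagator `p` which is first met at step `K`, has the
lowest priority there, and is certain to be deleted at step `K` or `K + 1`. -/
lemma gnPick_erase [NeZero n] {P : Finset (Prp n)} {p : Prp n} {m u w : ZMod n} {K : ℕ}
    (hp : p ∈ P) (hu : m + (K : ZMod n) = u) (hw : m + ((K + 1 : ℕ) : ZMod n) = w)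
    (hpu : u ∈ supp n p) (hpw : w ∈ supp n p)
    (hbefore : ∀ t < K, m + (t : ZMod n) ∉ supp n p)
    (hkey : ∀ r ∈ P, r ≠ p → u ∈ supp n r → cwKey n u p < cwKey n u r)
    (honly : ∀ r ∈ P, r ≠ p → w ∈ supp n r → u ∈ supp n r ∧
      ∀ x ∈ P, x ≠ p → u ∈ supp n x → x = r) :
    (∀ t, t ≠ K → t ≠ K + 1 → gnPick P m t = gnPick (P.erase p) m t) ∧
      gnPick P m K ≠ none ∧
      (gnPick P m (K + 1) ≠ none ↔ gnPick (P.erase p) m K ≠ none) ∧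
      gnPick (P.erase p) m (K + 1) = none := by
  set V := P.erase p with hV
  have hVP (t : ℕ) {r : Prp n} (hr : r ∈ (gnRun n V m t).1) : r ≠ p ∧ r ∈ P :=
    Finset.mem_erase.1 (gnRun_fst_subset V m t hr)
  have hpV (t : ℕ) : p ∉ (gnRun n V m t).1 := fun h => (hVP t h).1 rfl
  have hpick (t : ℕ) (ht : t < K) (h : (gnRun n P m t).1 = insert p (gnRun n V m t).1) :
      gnPick P m t = gnPick V m t := by
    rw [gnPick, gnPick, h, pickCW_insert (hbefore t ht)]
  have hinsert (t : ℕ) (ht : t ≤ K) : (gnRun n P m t).1 = insert p (gnRun n V m t).1 := by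
    induction t with
    | zero => exact (Finset.insert_erase hp).symm
    | succ t ih =>
      have h := ih (by omega)
      have hPV := hpick t (by omega) h
      cases hQ : gnPick V m t with
      | none => rw [gnRun_succ_of_none hQ, gnRun_succ_of_none (hPV.trans hQ), h]
      | some x =>
        have hx : p ≠ x := fun e => hpV t (e ▸ (pickCW_spec hQ).1)
        rw [gnRun_succ_of_some hQ, gnRun_succ_of_some (hPV.trans hQ), h]
        exact Finset.erase_insert_of_ne hx
  have hK := hinsert K le_rfl
  have hmid : gnPick P m K ≠ none ∧ (gnPick P m (K + 1) ≠ none ↔ gnPick V m K ≠ none) ∧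
      gnPick V m (K + 1) = none ∧ (gnRun n P m (K + 2)).1 = (gnRun n V m (K + 2)).1 := by
    cases hQ : gnPick V m K with
    | none =>
      have hnone : ∀ r ∈ (gnRun n V m K).1, u ∉ supp n r := by
        rw [← hu]; exact pickCW_eq_none.1 hQ
      have hPK : gnPick P m K = some p := by
        rw [gnPick, hK, hu]
        refine pickCW_eq_some (Finset.mem_insert_self _ _) hpu fun r hr hru => ?_
        rcases Finset.mem_insert.1 hr with rfl | hr
        · exact le_rfl
        · exact absurd hru (hnone r hr)
      have hrun : (gnRun n P m (K + 1)).1 = (gnRun n V m (K + 1)).1 := by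
        rw [gnRun_succ_of_some hPK, gnRun_succ_of_none hQ, hK]
        exact Finset.erase_insert (hpV K)
      have hVK : gnPick V m (K + 1) = none := by
        rw [gnPick, hw, gnRun_succ_of_none hQ, pickCW_eq_none]
        exact fun r hr hrw => hnone r hr (honly r (hVP K hr).2 (hVP K hr).1 hrw).1
      obtain ⟨h1, h2⟩ := gnRun_fst_step hrun
      exact ⟨by simp [hPK], by simp [h1, hVK], hVK, h2⟩
    | some x =>
      obtain ⟨hx, hxu, hxmax⟩ := pickCW_spec hQ
      rw [hu] at hxu hxmax
      have hPK : gnPick P m K = some x := by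
        rw [gnPick, hK, hu]
        refine pickCW_eq_some (Finset.mem_insert_of_mem hx) hxu fun r hr hru => ?_
        rcases Finset.mem_insert.1 hr with rfl | hr
        · exact (hkey x (hVP K hx).2 (hVP K hx).1 hxu).le
        · exact hxmax r hr hru
      have hrun : (gnRun n P m (K + 1)).1 = insert p (gnRun n V m (K + 1)).1 := by
        rw [gnRun_succ_of_some hPK, gnRun_succ_of_some hQ, hK]
        exact Finset.erase_insert_of_ne (hVP K hx).1.symm
      have hnone : ∀ r ∈ (gnRun n V m (K + 1)).1, w ∉ supp n r := by
        intro r hr hrw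
        have hxr := (honly r (hVP _ hr).2 (hVP _ hr).1 hrw).2 x (hVP K hx).2 (hVP K hx).1 hxu
        rw [gnRun_succ_of_some hQ] at hr
        exact (Finset.mem_erase.1 hr).1 hxr.symm
      have hVK : gnPick V m (K + 1) = none := by
        rw [gnPick, hw, pickCW_eq_none]
        exact hnone
      have hPK1 : gnPick P m (K + 1) = some p := by
        rw [gnPick, hrun, hw]
        refine pickCW_eq_some (Finset.mem_insert_self _ _) hpw fun r hr hrw => ?_
        rcases Finset.mem_insert.1 hr with rfl | hr
        · exact le_rfl
        · exact absurd hrw (hnone r hr)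
      refine ⟨by simp [hPK], by simp [hPK1], hVK, ?_⟩
      rw [gnRun_succ_of_some hPK1, gnRun_succ_of_none hVK, hrun]
      exact Finset.erase_insert (hpV _)
  obtain ⟨h1, h2, h3, h4⟩ := hmid
  have hafter (s : ℕ) : (gnRun n P m (K + 2 + s)).1 = (gnRun n V m (K + 2 + s)).1 := by
    induction s with
    | zero => exact h4
    | succ s ih => exact (gnRun_fst_step ih).2
  refine ⟨fun t ht ht' => ?_, h1, h2, h3⟩
  rcases lt_or_ge t K with hlt | hge
  · exact hpick t hlt (hinsert t hlt.le)
  · obtain ⟨s, rfl⟩ := Nat.exists_eq_add_of_le (show K + 2 ≤ t by omega)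
    exact (gnRun_fst_step (hafter s)).1

lemma neg_natCast_eq_one_add {j : ℕ} (hj : j + 1 ≤ n) :
    -(j : ZMod n) = 1 + ((n - (j + 1) : ℕ) : ZMod n) := by
  rw [Nat.cast_sub hj, ZMod.natCast_self]
  push_cast
  ring

lemma ord_one_neg {j : ℕ} (hj : j + 1 ≤ n) : ord n 1 (-(j : ZMod n)) = n - (j + 1) :=
  ord_eq_of_eq (by omega) (neg_natCast_eq_one_add hj)

end RunLemmas

/-- plusses from the intermediate terms `I_m^W`.
Under the Setup, suppose additionally that whenever `n-2 ∈ I_{n-2}^V` we also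
have `n-1 ∈ I_{n-2}^V`.  Then for each `m` with `1 < m < n-2`, the necklace term
`I_m^W` contributes the same plusses as `I_m^V`, except that if `I_m^V`
contributed a plus in column `n-3` of the Le diagram of `V` then that plus is
shifted one square left (into column `n-2`) in the Le diagram of `W`. -/
theorem lePlus_of_intermediate_terms
    (n : ℕ) [NeZero n] (P : Finset (Prp n))
    (hadm : IsAdmissible n P) (hne : P.Nonempty)
    (hp : (s(-3, -1) : Prp n) ∈ P)
    (hlen : plength n (s(-3, -1) : Prp n) = 2)
    (hin : ∀ r ∈ P, InsideDir n (-3) (s(-3, -1) : Prp n) r → r = (s(-3, -1) : Prp n))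
    (hedge : (∀ r ∈ P, (-3 : ZMod n) ∈ r → r = (s(-3, -1) : Prp n)) ∨
      ((s(-5, -3) : Prp n) ∈ P ∧ plength n (s(-5, -3) : Prp n) = 2 ∧
        (∀ r ∈ P, (-3 : ZMod n) ∈ r →
          r = (s(-3, -1) : Prp n) ∨ r = (s(-5, -3) : Prp n)) ∧
        (∀ r ∈ P, InsideDir n (-5) (s(-5, -3) : Prp n) r → r = (s(-5, -3) : Prp n))))
    (hcond : (-2 : ZMod n) ∈ gnSet n (eraseP n P) (-2) →
      (-1 : ZMod n) ∈ gnSet n (eraseP n P) (-2)) :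
    ∀ m : ZMod n, m ≠ 1 → ord n 1 m < n - 3 →
      ∀ a b : ZMod n,
        LePlusAt n (gnSet n P 1) (gnSet n P m) a b ↔
          ((b ≠ -3 ∧
              LePlusAt n (gnSet n (eraseP n P) 1) (gnSet n (eraseP n P) m) a b) ∨
           (b = -2 ∧
              LePlusAt n (gnSet n (eraseP n P) 1) (gnSet n (eraseP n P) m) a (-3))) := by
  intro m hm1 hm a b
  have hn : 5 ≤ n := by
    have := hadm.card_add_four_le
    have := hne.card_pos
    omega
  have o3 : ord n 1 (-3) = n - 4 := by simpa using ord_one_neg (n := n) (j := 3) (by omega)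
  have o2 : ord n 1 (-2) = n - 3 := by simpa using ord_one_neg (n := n) (j := 2) (by omega)
  have o1 : ord n 1 (-1) = n - 2 := by simpa using ord_one_neg (n := n) (j := 1) (by omega)
  have o0 : ord n 1 0 = n - 1 := by simpa using ord_one_neg (n := n) (j := 0) (by omega)
  have hsupp (v : ZMod n) (hv : v ∈ supp n s(-3, -1)) : n - 4 ≤ ord n 1 v := by
    simp only [supp, Sym2.lift_mk, Finset.mem_insert, Finset.mem_singleton] at hv
    rcases hv with rfl | rfl | rfl | rfl
    · omega
    · rw [show (-3 + 1 : ZMod n) = -2 by ring]; omega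
    · omega
    · rw [show (-1 + 1 : ZMod n) = 0 by ring]; omega
  have hmem3 : (-3 : ZMod n) ∈ supp n s(-3, -1) := mem_supp.2 (.inl (Sym2.mem_mk_left _ _))
  have hmem2 : (-2 : ZMod n) ∈ supp n s(-3, -1) :=
    mem_supp.2 (.inr (by rw [show (-2 - 1 : ZMod n) = -3 by ring]; exact Sym2.mem_mk_left _ _))
  have hmiddle2 (r : Prp n) (hr : r ∈ P) : (-2 : ZMod n) ∉ r := by
    have e : (-1 : ZMod n) = -3 + 2 := by ring
    rw [e] at hp hin
    rw [show (-2 : ZMod n) = -3 + 1 by ring]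
    exact middle_edge_notMem hadm hp hin hr
  have hq (r : Prp n) (hr : r ∈ P) (hrp : r ≠ s(-3, -1)) (h3 : (-3 : ZMod n) ∈ r) :
      r = s(-3, -5) ∧ ∀ x ∈ P, (-4 : ZMod n) ∉ x := by
    rcases hedge with h | ⟨hqP, -, h, hqin⟩
    · exact absurd (h r hr h3) hrp
    · refine ⟨((h r hr h3).resolve_left hrp).trans Sym2.eq_swap, fun x hx => ?_⟩
      have e : (-3 : ZMod n) = -5 + 2 := by ring
      rw [e] at hqP hqin
      rw [show (-4 : ZMod n) = -5 + 1 by ring]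
      exact middle_edge_notMem hadm hqP hqin hx
  have e4 : (-3 - 1 : ZMod n) = -4 := by ring
  have hp4 : (-3 - 1 : ZMod n) ∉ (s(-3, -1) : Prp n) := by
    rw [Sym2.mem_iff]
    rintro (h | h)
    · have h1 : (0 : ZMod n) = 1 := by linear_combination h
      rw [h1] at o0
      simp [ord] at o0
      omega
    · have h1 : (-2 : ZMod n) = 1 := by linear_combination h
      rw [h1] at o2
      simp [ord] at o2
      omega
  have hpkey : cwKey n (-3) s(-3, -1) = 2 := by
    rw [cwKey, if_neg hp4, otherEnd_mk]
    exact ord_eq_of_eq (by omega) (by push_cast; ring)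
  have hkey (r : Prp n) (hr : r ∈ P) (hrp : r ≠ s(-3, -1)) (h3 : (-3 : ZMod n) ∈ supp n r) :
      cwKey n (-3) s(-3, -1) < cwKey n (-3) r := by
    rw [hpkey, cwKey]
    split_ifs with h
    · omega
    · obtain ⟨rfl, -⟩ := hq r hr hrp ((mem_supp.1 h3).resolve_right h)
      rw [otherEnd_mk, ord_eq_of_eq (k := n - 2) (by omega)]
      · omega
      · rw [Nat.cast_sub (by omega), ZMod.natCast_self]; push_cast; ring
  have honly (r : Prp n) (hr : r ∈ P) (hrp : r ≠ s(-3, -1)) (h2 : (-2 : ZMod n) ∈ supp n r) :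
      (-3 : ZMod n) ∈ supp n r ∧
        ∀ x ∈ P, x ≠ s(-3, -1) → (-3 : ZMod n) ∈ supp n x → x = r := by
    have h3 : (-3 : ZMod n) ∈ r := by
      have := (mem_supp.1 h2).resolve_left (hmiddle2 r hr)
      rwa [show (-2 - 1 : ZMod n) = -3 by ring] at this
    obtain ⟨hrq, h4⟩ := hq r hr hrp h3
    refine ⟨mem_supp.2 (.inl h3), fun x hx hxp hx3 => ?_⟩
    rw [mem_supp, e4] at hx3
    exact (hq x hx hxp (hx3.resolve_right (h4 x hx))).1.trans hrq.symm
  have hset (c : ZMod n) (hc : ord n 1 c < n - 3) :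
      (∀ v : ZMod n, v ≠ -3 → v ≠ -2 → (v ∈ gnSet n P c ↔ v ∈ gnSet n (eraseP n P) c)) ∧
      (-3 : ZMod n) ∈ gnSet n P c ∧
      ((-2 : ZMod n) ∈ gnSet n P c ↔ (-3 : ZMod n) ∈ gnSet n (eraseP n P) c) ∧
      (-2 : ZMod n) ∉ gnSet n (eraseP n P) c := by
    obtain ⟨K, hK⟩ := Nat.exists_eq_add_of_le (show ord n 1 c ≤ n - 4 by omega)
    have hu : c + (K : ZMod n) = -3 := by
      rw [← add_ord 1 (-3 : ZMod n), o3, hK, Nat.cast_add, ← add_assoc, add_ord]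
    have hw : c + ((K + 1 : ℕ) : ZMod n) = -2 := by
      rw [Nat.cast_add, ← add_assoc, hu]; push_cast; ring
    have hbefore (t : ℕ) (ht : t < K) : c + (t : ZMod n) ∉ supp n s(-3, -1) := by
      intro h
      have h1 := hsupp _ h
      rw [ord_eq_of_eq (k := ord n 1 c + t) (by omega)
        (by rw [Nat.cast_add, ← add_assoc, add_ord])] at h1
      omega
    obtain ⟨h1, h2, h3, h4⟩ := gnPick_erase hp hu hw hmem3 hmem2 hbefore hkey honly
    have ou : ord n c (-3) = K := ord_eq_of_eq (by omega) hu.symm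
    have ow : ord n c (-2) = K + 1 := ord_eq_of_eq (by omega) hw.symm
    simp only [mem_gnSet, ou, ow, eraseP]
    refine ⟨fun v hv3 hv2 => ?_, h2, h3, by simpa using h4⟩
    rw [h1 _ (fun h => hv3 (ord_inj.1 (h.trans ou.symm)))
      (fun h => hv2 (ord_inj.1 (h.trans ow.symm)))]
  obtain ⟨hA, huA, hwA, hwA'⟩ := hset 1 (by simp [ord]; omega)
  obtain ⟨hB, huB, hwB, hwB'⟩ := hset m hm
  exact lePlusAt_swap_iff (by omega) hA hB huA huB hwA hwB hwA' hwB'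
    (mem_gnSet_of_mem_gnSet (by omega))

end WLD
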